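/- Let a > 0 and A₀ > 0 and define the network throughput function Υ(ε) = A₀·exp(−a/ε)·(1 − ε) on the open interval (0, 1). Then ε̃ = (√(a² + 4a) − a)/2 lies in (0, 1), and Υ attains a strict global maximum over (0, 1) at ε = ε̃; that is, Υ(ε) < Υ(ε̃) for every ε ∈ (0,1) with ε ≠ ε̃. -/

import Mathlib

open Real Set

/-- If `s ^ 2 = a * (1 - s)`, then `x ↦ exp (-a / x) * (1 - x)` is strictly smaller at every other
positive `x` than at `s`. -/
theorem exp_neg_div_mul_one_sub_lt {a s x : ℝ} (hs : s ∈ Ioo (0 : ℝ) 1)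
    (hsa : s ^ 2 = a * (1 - s)) (hx : 0 < x) (hne : x ≠ s) :
    Real.exp (-a / x) * (1 - x) < Real.exp (-a / s) * (1 - s) := by
  obtain ⟨hs0, hs1⟩ := hs
  have h1s : 0 < 1 - s := sub_pos.2 hs1
  have ha : a = s ^ 2 / (1 - s) := by rw [hsa, mul_div_cancel_right₀ _ h1s.ne']
  have hgap : (a / x - a / s + 1) * (1 - s) - (1 - x) = (s - x) ^ 2 / x := by
    rw [ha]
    field_simp
    ring
  have hpos : 0 < (s - x) ^ 2 / x := div_pos (sq_pos_of_ne_zero (sub_ne_zero.2 hne.symm)) hx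
  have hexp : (a / x - a / s + 1) * (1 - s) ≤ Real.exp (a / x - a / s) * (1 - s) :=
    mul_le_mul_of_nonneg_right (Real.add_one_le_exp _) h1s.le
  calc Real.exp (-a / x) * (1 - x)
      < Real.exp (-a / x) * (Real.exp (a / x - a / s) * (1 - s)) :=
        mul_lt_mul_of_pos_left (by linarith) (Real.exp_pos _)
    _ = Real.exp (-a / s) * (1 - s) := by
        rw [← mul_assoc, ← Real.exp_add]
        congr 2
        ring

/-- Corollary 1: the network throughput `Υ(ε) = A₀·exp(−a/ε)·(1 − ε)` on the open interval
`(0,1)` attains a strict global maximum at the optimal explore/exploit duty cycle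
`ε̃ = (√(a² + 4a) − a)/2`, which lies in `(0,1)`, for any constants `a > 0` and `A₀ > 0`. -/
theorem optimal_duty_cycle (a A₀ : ℝ) (ha : 0 < a) (hA₀ : 0 < A₀) :
    let Υ : ℝ → ℝ := fun ε => A₀ * Real.exp (-a / ε) * (1 - ε)
    let εopt : ℝ := (Real.sqrt (a ^ 2 + 4 * a) - a) / 2
    εopt ∈ Ioo (0 : ℝ) 1 ∧ ∀ ε ∈ Ioo (0 : ℝ) 1, ε ≠ εopt → Υ ε < Υ εopt := by
  intro Υ εopt
  have hsq : Real.sqrt (a ^ 2 + 4 * a) ^ 2 = a ^ 2 + 4 * a := Real.sq_sqrt (by positivity)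
  have hlower : a < Real.sqrt (a ^ 2 + 4 * a) := Real.lt_sqrt_of_sq_lt (by linarith)
  have hupper : Real.sqrt (a ^ 2 + 4 * a) < a + 2 :=
    (Real.sqrt_lt' (by linarith)).2 (by linarith [add_sq a 2])
  have hmem : εopt ∈ Ioo (0 : ℝ) 1 := ⟨by dsimp only [εopt]; linarith, by dsimp only [εopt]; linarith⟩
  have hcrit : εopt ^ 2 = a * (1 - εopt) := by
    dsimp only [εopt]
    linear_combination hsq / 4
  refine ⟨hmem, fun ε hε hne => ?_⟩
  simpa only [Υ, mul_assoc] using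
    mul_lt_mul_of_pos_left (exp_neg_div_mul_one_sub_lt hmem hcrit hε.1 hne) hA₀
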